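/- Let X and Y be finite-dimensional real normed vector spaces, U ⊆ X and V ⊆ Y nonempty open subsets, and let g : U → V and f : V → U be inverse homeomorphisms. Let x ∈ U. Assume g has a Gâteaux derivative D : X → Y at x (a continuous linear map with D(v) = lim_{t→0⁺}(g(x+tv) − g(x))/t for all v ∈ X), and assume f is Lipschitz on V. Then D is a linear isomorphism of X onto Y (D is bijective). -/

import Mathlib

open Filter Topology

section LipschitzLocalSurjectivity

open MeasureTheory Measure Set Metric

/-- Lagrange interpolation of the polynomial `t ↦ det (1 + t • A)`. -/
theorem ContinuousLinearMap.det_one_add_smul_eq_sum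
    {E : Type*} [NormedAddCommGroup E] [NormedSpace ℝ E] [FiniteDimensional ℝ E]
    (A : E →L[ℝ] E) {s : Finset ℝ} (hs : Module.finrank ℝ E < s.card) (t : ℝ) :
    (1 + t • A).det =
      ∑ i ∈ s, (Lagrange.basis s id i).eval t * (1 + i • A).det := by
  classical
  let b := Module.finBasis ℝ E
  let M := LinearMap.toMatrix b b (A : E →ₗ[ℝ] E)
  let P : Polynomial ℝ := ((Polynomial.X : Polynomial ℝ) • M.map Polynomial.C +
    (1 : Matrix (Fin (Module.finrank ℝ E)) (Fin (Module.finrank ℝ E)) ℝ).map Polynomial.C).det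
  have hP : ∀ r : ℝ, P.eval r = (1 + r • A).det := by
    intro r
    have h : (1 + r • A).det = (1 + r • M).det := by
      rw [ContinuousLinearMap.det, ← LinearMap.det_toMatrix b]
      congr 1
      simp [M, map_add, LinearMap.toMatrix_one]
    rw [h, ← Polynomial.coe_evalRingHom, RingHom.map_det]
    congr 1
    ext i j
    by_cases hij : i = j <;> simp [hij, add_comm, mul_comm (M _ _)]
  have hdeg : P.degree < s.card := by
    refine Polynomial.degree_le_natDegree.trans_lt ?_
    have := Polynomial.natDegree_det_X_add_C_le M 1
    rw [Fintype.card_fin] at this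
    exact_mod_cast this.trans_lt hs
  have h := congrArg (Polynomial.eval t)
    (Lagrange.eq_interpolate (v := id) (Set.injOn_id _) hdeg)
  rw [hP, Lagrange.interpolate_apply, Polynomial.eval_finsetSum] at h
  rw [h]
  refine Finset.sum_congr rfl fun i _ => ?_
  rw [Polynomial.eval_mul, Polynomial.eval_C, id, hP, mul_comm]

theorem ContinuousLinearMap.det_one_add_pos_of_norm_lt_one
    {E : Type*} [NormedAddCommGroup E] [NormedSpace ℝ E] [FiniteDimensional ℝ E]
    {A : E →L[ℝ] E} (hA : ‖A‖ < 1) : 0 < (1 + A).det := by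
  have hne : ∀ s ∈ Icc (0 : ℝ) 1, (1 + s • A).det ≠ 0 := by
    intro s hs h0
    obtain ⟨v, hv, hv0⟩ := (Submodule.ne_bot_iff _).1
      (LinearMap.bot_lt_ker_of_det_eq_zero h0).ne'
    have hv' : v = -(s • A v) := by
      have : v + s • A v = 0 := by simpa using hv
      exact eq_neg_of_add_eq_zero_left this
    have h1 : ‖v‖ ≤ ‖A‖ * ‖v‖ := by
      calc ‖v‖ = s * ‖A v‖ := by
            conv_lhs => rw [hv', norm_neg, norm_smul, Real.norm_of_nonneg hs.1]
        _ ≤ 1 * ‖A v‖ := by gcongr; exact hs.2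
        _ ≤ ‖A‖ * ‖v‖ := by rw [one_mul]; exact A.le_opNorm v
    nlinarith [norm_pos_iff.2 hv0]
  by_contra! hneg
  have hcont : ContinuousOn (fun s : ℝ => (1 + s • A).det) (Icc 0 1) :=
    (ContinuousLinearMap.continuous_det.comp (by fun_prop)).continuousOn
  obtain ⟨s, hs, hs0⟩ := intermediate_value_Icc' zero_le_one hcont
    (show (0 : ℝ) ∈ Icc _ _ from ⟨by simpa using hneg, by simp [ContinuousLinearMap.det]⟩)
  exact hne s hs hs0

section NoRetraction

variable {E : Type*} [NormedAddCommGroup E] [NormedSpace ℝ E]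
  {w : E → E} {K : NNReal} {t : ℝ}

theorem LipschitzWith.injective_add_smul (hw : LipschitzWith K w) (ht0 : 0 ≤ t)
    (htK : t * K < 1) : Function.Injective fun z => z + t • w z := by
  intro a b hab
  by_contra hne
  have h1 : a - b = t • (w b - w a) := by
    rw [smul_sub, sub_eq_sub_iff_add_eq_add, add_comm (t • w b) b]
    exact hab
  have h2 : ‖a - b‖ ≤ t * K * ‖a - b‖ := by
    conv_lhs => rw [h1, norm_smul, Real.norm_of_nonneg ht0]
    rw [mul_assoc, norm_sub_rev a b]
    gcongr
    exact hw.norm_sub_le b a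
  nlinarith [norm_pos_iff.2 (sub_ne_zero.2 hne)]

variable [FiniteDimensional ℝ E]

theorem LipschitzWith.surjective_add_smul (hw : LipschitzWith K w) (ht0 : 0 ≤ t)
    (htK : t * K < 1) : Function.Surjective fun z => z + t • w z := by
  intro p
  have hc : ContractingWith (t.toNNReal * K) fun z => p - t • w z := by
    refine ⟨?_, LipschitzWith.of_dist_le_mul fun a b => ?_⟩
    · rw [← NNReal.coe_lt_coe]
      simpa [ht0] using htK
    · rw [dist_sub_left, dist_smul₀, Real.norm_of_nonneg ht0, NNReal.coe_mul,
        Real.coe_toNNReal _ ht0, mul_assoc]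
      gcongr
      exact hw.dist_le_mul a b
  refine ⟨hc.fixedPoint, ?_⟩
  have h := hc.fixedPoint_isFixedPt
  dsimp only
  nth_rewrite 1 [← h]
  simp

theorem LipschitzWith.image_ball_add_smul (hw : LipschitzWith K w)
    (hw0 : ∀ z, 1 ≤ ‖z‖ → w z = 0) (ht0 : 0 ≤ t) (htK : t * K < 1) :
    (fun z => z + t • w z) '' ball 0 1 = ball 0 1 := by
  have hfix : ∀ z, 1 ≤ ‖z‖ → z + t • w z = z := fun z hz => by simp [hw0 z hz]
  ext p
  constructor
  · rintro ⟨z, hz, rfl⟩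
    by_contra hp
    simp only [mem_ball_zero_iff, not_lt] at hp hz
    have := hw.injective_add_smul ht0 htK (hfix _ hp)
    dsimp only at this
    rw [this] at hp
    exact absurd hz hp.not_gt
  · intro hp
    obtain ⟨z, rfl⟩ := hw.surjective_add_smul ht0 htK p
    refine ⟨z, ?_, rfl⟩
    by_contra hz
    simp only [mem_ball_zero_iff, not_lt] at hp hz
    rw [hfix z hz] at hp
    exact absurd hp hz.not_gt

variable [MeasurableSpace E] [BorelSpace E]

theorem LipschitzWith.addHaar_image_eq_zero {h : E → E} {C : NNReal} (hh : LipschitzWith C h)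
    (μ : Measure E) [μ.IsAddHaarMeasure] {s : Set E} (hs : μ s = 0) : μ (h '' s) = 0 := by
  have hH : μH[Module.finrank ℝ E] s = 0 := absolutelyContinuous_isAddHaarMeasure _ μ hs
  refine absolutelyContinuous_isAddHaarMeasure μ μH[Module.finrank ℝ E] ?_
  refine le_antisymm ((hh.lipschitzOnWith.hausdorffMeasure_image_le (Nat.cast_nonneg _)).trans ?_)
    zero_le
  rw [hH, mul_zero]

theorem LipschitzWith.integral_det_one_add_smul_fderiv (hw : LipschitzWith K w)
    (hw0 : ∀ z, 1 ≤ ‖z‖ → w z = 0) (ht0 : 0 ≤ t) (htK : t * K < 1)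
    (μ : Measure E) [μ.IsAddHaarMeasure] :
    IntegrableOn (fun z => (1 + t • fderiv ℝ w z).det)
      (ball 0 1 ∩ {z | DifferentiableAt ℝ w z}) μ ∧
    ∫ z in ball 0 1 ∩ {z | DifferentiableAt ℝ w z}, (1 + t • fderiv ℝ w z).det ∂μ =
      μ.real (ball 0 1) := by
  set S : Set E := ball 0 1 ∩ {z | DifferentiableAt ℝ w z} with hS
  set h : E → E := fun z => z + t • w z with hh
  have hSm : MeasurableSet S := measurableSet_ball.inter (measurableSet_of_differentiableAt ℝ w)
  have hlip : LipschitzWith (1 + ‖t‖₊ * K) h :=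
    LipschitzWith.id.add ((lipschitzWith_smul t).comp hw)
  have hder : ∀ z ∈ S, HasFDerivWithinAt h (1 + t • fderiv ℝ w z) S z := fun z hz =>
    ((hasFDerivAt_id z).add (hz.2.hasFDerivAt.const_smul t)).hasFDerivWithinAt
  have hinj : InjOn h S := (hw.injective_add_smul ht0 htK).injOn
  have habs : ∀ z, |(1 + t • fderiv ℝ w z).det| = (1 + t • fderiv ℝ w z).det := by
    intro z
    refine abs_of_pos (ContinuousLinearMap.det_one_add_pos_of_norm_lt_one ?_)
    rw [norm_smul, Real.norm_of_nonneg ht0]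
    exact (mul_le_mul_of_nonneg_left (norm_fderiv_le_of_lipschitz ℝ hw) ht0).trans_lt htK
  have hnull : μ (ball 0 1 \ S) = 0 := by
    refine measure_mono_null ?_ (ae_iff.1 (hw.ae_differentiableAt (μ := μ)))
    rintro z ⟨hz, hzS⟩ hd
    exact hzS ⟨hz, hd⟩
  have himg := hw.image_ball_add_smul hw0 ht0 htK
  have hvol : μ (h '' S) = μ (ball 0 1) := by
    refine le_antisymm (measure_mono ?_) ?_
    · rw [← himg]
      exact image_mono inter_subset_left
    · calc μ (ball 0 1) = μ (h '' S ∪ h '' (ball 0 1 \ S)) := by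
            rw [← image_union, union_sdiff_cancel inter_subset_left, himg]
        _ ≤ μ (h '' S) + μ (h '' (ball 0 1 \ S)) := measure_union_le _ _
        _ = μ (h '' S) := by rw [hlip.addHaar_image_eq_zero μ hnull, add_zero]
  have hint := integrableOn_image_iff_integrableOn_abs_det_fderiv_smul μ hSm hder hinj
    fun _ => (1 : ℝ)
  have heq := integral_image_eq_integral_abs_det_fderiv_smul μ hSm hder hinj fun _ => (1 : ℝ)
  simp only [habs, smul_eq_mul, mul_one] at hint heq
  refine ⟨hint.1 (integrableOn_const (hvol ▸ measure_ball_lt_top.ne)), ?_⟩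
  rw [← heq, setIntegral_const, smul_eq_mul, mul_one, Measure.real, hvol, Measure.real]

end NoRetraction

/-- There is no Lipschitz retraction of the closed unit ball onto the unit sphere. -/
theorem LipschitzWith.not_forall_norm_add_eq_one
    {E : Type*} [NormedAddCommGroup E] [InnerProductSpace ℝ E] [FiniteDimensional ℝ E]
    {w : E → E} {K : NNReal} (hw : LipschitzWith K w) (hw0 : ∀ z, 1 ≤ ‖z‖ → w z = 0) :
    ¬ ∀ z, ‖z‖ < 1 → ‖z + w z‖ = 1 := by
  intro hone
  borelize E
  let μ : Measure E := μH[Module.finrank ℝ E]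
  have hdet : ∀ z ∈ ball (0 : E) 1 ∩ {z | DifferentiableAt ℝ w z},
      (1 + (1 : ℝ) • fderiv ℝ w z).det = 0 := by
    rintro z ⟨hz, hd⟩
    by_contra hne
    have hder : HasFDerivAt (fun z => z + w z) (1 + (1 : ℝ) • fderiv ℝ w z) z := by
      rw [one_smul]
      exact (hasFDerivAt_id z).add hd.hasFDerivAt
    have hconst : (fun z => ‖z + w z‖ ^ 2) =ᶠ[𝓝 z] fun _ => (1 : ℝ) := by
      filter_upwards [isOpen_ball.mem_nhds hz] with y hy
      rw [hone y (by simpa using hy), one_pow]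
    have h0 := (hder.norm_sq.congr_of_eventuallyEq hconst.symm).unique (hasFDerivAt_const 1 z)
    have hunit : IsUnit ((1 + (1 : ℝ) • fderiv ℝ w z : E →L[ℝ] E) : E →ₗ[ℝ] E) :=
      (LinearMap.isUnit_iff_isUnit_det _).2 (isUnit_iff_ne_zero.2 hne)
    obtain ⟨v, hv⟩ := ((Module.End.isUnit_iff _).1 hunit).2 (z + w z)
    have h1 := DFunLike.congr_fun h0 v
    rw [ContinuousLinearMap.coe_coe] at hv
    simp only [_root_.smul_apply, ContinuousLinearMap.comp_apply, hv,
      innerSL_apply_apply, real_inner_self_eq_norm_sq, hone z (by simpa using hz)] at h1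
    norm_num at h1
  obtain ⟨s, hsI, hsc⟩ := (Ioo_infinite (show (0 : ℝ) < 1 / (K + 1) by positivity)
    ).exists_subset_card_eq (Module.finrank ℝ E + 1)
  have hs : ∀ i ∈ s, 0 ≤ i ∧ i * K < 1 := by
    intro i hi
    have h := hsI hi
    refine ⟨h.1.le, ?_⟩
    have h2 := (lt_div_iff₀ (by positivity)).1 h.2
    nlinarith [h.1]
  have hint : ∫ z in ball 0 1 ∩ {z | DifferentiableAt ℝ w z},
      (1 + (1 : ℝ) • fderiv ℝ w z).det ∂μ = μ.real (ball 0 1) := by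
    calc _ = ∫ z in ball 0 1 ∩ {z | DifferentiableAt ℝ w z},
          ∑ i ∈ s, (Lagrange.basis s id i).eval 1 * (1 + i • fderiv ℝ w z).det ∂μ := by
          simp_rw [fun z => (fderiv ℝ w z).det_one_add_smul_eq_sum (s := s) (by omega) 1]
      _ = ∑ i ∈ s, (Lagrange.basis s id i).eval 1 * μ.real (ball 0 1) := by
          rw [integral_finsetSum _ fun i hi => ((hw.integral_det_one_add_smul_fderiv hw0
            (hs i hi).1 (hs i hi).2 μ).1.integrable.const_mul _)]
          refine Finset.sum_congr rfl fun i hi => ?_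
          rw [integral_const_mul, (hw.integral_det_one_add_smul_fderiv hw0
            (hs i hi).1 (hs i hi).2 μ).2]
      _ = μ.real (ball 0 1) := by
          rw [← Finset.sum_mul, ← Polynomial.eval_finsetSum,
            Lagrange.sum_basis (injOn_id _) (Finset.card_pos.1 (by omega)),
            Polynomial.eval_one, one_mul]
  rw [setIntegral_congr_fun (measurableSet_ball.inter (measurableSet_of_differentiableAt ℝ w))
    hdet, integral_zero] at hint
  exact (ENNReal.toReal_pos (measure_ball_pos μ 0 one_pos).ne' measure_ball_lt_top.ne).ne hint

/-- A locally Lipschitz map vanishing outside the open unit ball is Lipschitz. -/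
theorem LocallyLipschitz.exists_lipschitzWith_of_eq_zero
    {E F : Type*} [NormedAddCommGroup E] [NormedSpace ℝ E] [FiniteDimensional ℝ E]
    [NormedAddCommGroup F] {w : E → F} (hw : LocallyLipschitz w)
    (hw0 : ∀ z, 1 ≤ ‖z‖ → w z = 0) : ∃ K, LipschitzWith K w := by
  have : ProperSpace E := FiniteDimensional.proper_real E
  obtain ⟨K, hK⟩ := hw.locallyLipschitzOn.exists_lipschitzOnWith_of_compact
    (isCompact_closedBall (0 : E) 2)
  have key : ∀ a b : E, ‖a‖ < 1 → dist (w a) (w b) ≤ 3 * K * dist a b := by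
    intro a b ha
    have ha2 : a ∈ closedBall (0 : E) 2 := by
      rw [mem_closedBall_zero_iff]; linarith
    rcases le_or_gt ‖b‖ 2 with hb | hb
    · refine (hK.dist_le_mul a ha2 b (by simpa using hb)).trans ?_
      have : 0 ≤ (K : ℝ) * dist a b := by positivity
      linarith
    · let q : E := (2 / ‖b‖) • b
      have hq : ‖q‖ = 2 := by
        rw [norm_smul, Real.norm_of_nonneg (by positivity),
          div_mul_cancel₀ _ (by linarith : ‖b‖ ≠ 0)]
      have h1 : dist a b ≥ 1 := by
        rw [dist_eq_norm, norm_sub_rev]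
        linarith [norm_sub_norm_le b a]
      have h2 : dist a q ≤ 3 := by
        rw [dist_eq_norm]
        linarith [norm_sub_le a q]
      rw [hw0 b (by linarith), ← hw0 q (by linarith)]
      calc dist (w a) (w q) ≤ K * dist a q := hK.dist_le_mul a ha2 q (by simp [hq])
        _ ≤ K * 3 := by gcongr
        _ ≤ 3 * K * dist a b := by nlinarith [K.coe_nonneg]
  refine ⟨3 * K, LipschitzWith.of_dist_le_mul fun a b => ?_⟩
  rw [NNReal.coe_mul, NNReal.coe_ofNat]
  rcases lt_or_ge ‖a‖ 1 with ha | ha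
  · exact key a b ha
  rcases lt_or_ge ‖b‖ 1 with hb | hb
  · rw [dist_comm, dist_comm a]
    exact key b a hb
  · rw [hw0 a ha, hw0 b hb, dist_self]
    positivity

theorem LocallyLipschitz.comp_contDiffAt
    {E F G : Type*} [PseudoEMetricSpace E] [NormedAddCommGroup F] [NormedSpace ℝ F]
    [NormedAddCommGroup G] [NormedSpace ℝ G] {k : E → F} {N : F → G} (hk : LocallyLipschitz k)
    (hN : ∀ z, ContDiffAt ℝ 1 N (k z)) : LocallyLipschitz fun z => N (k z) := by
  intro z
  obtain ⟨K₁, s, hs, h₁⟩ := (hN z).exists_lipschitzOnWith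
  obtain ⟨K₂, u, hu, h₂⟩ := hk z
  exact ⟨K₁ * K₂, u ∩ k ⁻¹' s, inter_mem hu (hk.continuous.continuousAt hs),
    h₁.comp (h₂.mono inter_subset_left) fun y hy => hy.2⟩

theorem LocallyLipschitz.smul_real
    {E F : Type*} [PseudoEMetricSpace E] [NormedAddCommGroup F] [NormedSpace ℝ F]
    {c : E → ℝ} {k : E → F} (hc : LocallyLipschitz c) (hk : LocallyLipschitz k) :
    LocallyLipschitz fun z => c z • k z :=
  (hc.prodMk hk).comp_contDiffAt (N := fun p : ℝ × F => p.1 • p.2)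
    fun _ => (contDiff_fst.smul contDiff_snd).contDiffAt

theorem LipschitzWith.exists_eq_zero_of_norm_sub_le
    {E : Type*} [NormedAddCommGroup E] [InnerProductSpace ℝ E] [FiniteDimensional ℝ E]
    {φ : E → E} {C : NNReal} (hφ : LipschitzWith C φ)
    (hclose : ∀ z, ‖z‖ ≤ 1 → ‖φ z - z‖ ≤ 1 / 4) : ∃ z, ‖z‖ ≤ 1 ∧ φ z = 0 := by
  by_contra! hne
  let χ : ContDiffBump (0 : E) := ⟨1 / 2, 1, by norm_num, by norm_num⟩
  let k : E → E := fun z => z + χ z • (φ z - z)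
  have hk : LocallyLipschitz k := LocallyLipschitz.id.add
    ((χ.contDiff (n := 1)).locallyLipschitz.smul_real (hφ.locallyLipschitz.sub .id))
  have hk1 : ∀ z, 1 ≤ ‖z‖ → k z = z := by
    intro z hz
    simp [k, χ.zero_of_le_dist (x := z) (by simpa [χ] using hz)]
  have hk0 : ∀ z, k z ≠ 0 := by
    intro z
    rcases le_or_gt ‖z‖ (1 / 2) with h | h
    · simpa [k, χ.one_of_mem_closedBall (x := z) (by simpa [χ] using h)] using
        hne z (by linarith)
    rcases le_or_gt ‖z‖ 1 with h' | h'
    · have h1 : ‖χ z • (φ z - z)‖ ≤ 1 / 4 := by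
        rw [norm_smul, Real.norm_of_nonneg χ.nonneg]
        calc χ z * ‖φ z - z‖ ≤ 1 * ‖φ z - z‖ := by gcongr; exact χ.le_one
          _ ≤ 1 / 4 := by rw [one_mul]; exact hclose z h'
      intro h0
      have h2 : ‖z‖ = ‖χ z • (φ z - z)‖ := by
        rw [← norm_neg (χ z • _), ← eq_neg_of_add_eq_zero_left h0]
      linarith
    · rw [hk1 z h'.le]
      rintro rfl
      simp at h'
      linarith
  have hN : LocallyLipschitz fun z => ‖k z‖⁻¹ • k z :=
    hk.comp_contDiffAt (N := fun u => ‖u‖⁻¹ • u) fun z =>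
      ((contDiffAt_norm ℝ (hk0 z)).inv (norm_ne_zero_iff.2 (hk0 z))).smul contDiffAt_id
  have hρ : LocallyLipschitz fun z => max ‖z‖ 1 • (‖k z‖⁻¹ • k z) - z :=
    ((lipschitzWith_one_norm.locallyLipschitz.max_const 1).smul_real hN).sub .id
  have hρ0 : ∀ z, 1 ≤ ‖z‖ → max ‖z‖ 1 • (‖k z‖⁻¹ • k z) - z = 0 := by
    intro z hz
    rw [hk1 z hz, max_eq_left hz, smul_smul, mul_inv_cancel₀ (by linarith), one_smul, sub_self]
  obtain ⟨K, hK⟩ := hρ.exists_lipschitzWith_of_eq_zero hρ0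
  refine hK.not_forall_norm_add_eq_one hρ0 fun z hz => ?_
  rw [add_sub_cancel, max_eq_right hz.le, one_smul, norm_smul, norm_inv, norm_norm,
    inv_mul_cancel₀ (norm_ne_zero_iff.2 (hk0 z))]

theorem LipschitzWith.exists_eq_of_norm_sub_le
    {E : Type*} [NormedAddCommGroup E] [InnerProductSpace ℝ E] [FiniteDimensional ℝ E]
    {φ : E → E} {C : NNReal} (hφ : LipschitzWith C φ) {r : ℝ} (hr : 0 < r) {p : E}
    (hclose : ∀ z, ‖z‖ ≤ r → ‖φ z - z‖ ≤ r / 8) (hp : ‖p‖ ≤ r / 8) :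
    ∃ z, ‖z‖ ≤ r ∧ φ z = p := by
  have hψ : LipschitzWith (‖r⁻¹‖₊ * (C * ‖r‖₊)) fun z => r⁻¹ • (φ (r • z) - p) := by
    refine (lipschitzWith_smul r⁻¹).comp (g := fun z => φ (r • z) - p) ?_
    have := (hφ.comp (lipschitzWith_smul (β := E) r)).sub (LipschitzWith.const p)
    rwa [add_zero] at this
  obtain ⟨z, hz, hz0⟩ := hψ.exists_eq_zero_of_norm_sub_le fun z hz => by
    have hrz : ‖r • z‖ ≤ r := by
      rw [norm_smul, Real.norm_of_nonneg hr.le]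
      nlinarith
    have h : r⁻¹ • (φ (r • z) - p) - z = r⁻¹ • ((φ (r • z) - r • z) - p) := by
      rw [smul_sub, smul_sub, smul_sub, inv_smul_smul₀ hr.ne']
      abel
    rw [h, norm_smul, norm_inv, Real.norm_of_nonneg hr.le, inv_mul_le_iff₀ hr]
    linarith [_root_.norm_sub_le (φ (r • z) - r • z) p, hclose _ hrz]
  refine ⟨r • z, ?_, ?_⟩
  · rw [norm_smul, Real.norm_of_nonneg hr.le]
    nlinarith
  · exact sub_eq_zero.1 ((smul_eq_zero.1 hz0).resolve_left (inv_ne_zero hr.ne'))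

/-- A Lipschitz map whose derivative at a point is the identity is open at that point. -/
theorem LipschitzWith.nhds_le_map_of_hasFDerivAt_id
    {X : Type*} [NormedAddCommGroup X] [NormedSpace ℝ X] [FiniteDimensional ℝ X]
    {ψ : X → X} {C : NNReal} (hψ : LipschitzWith C ψ)
    {a : X} (hd : HasFDerivAt ψ (ContinuousLinearMap.id ℝ X) a) :
    𝓝 (ψ a) ≤ map ψ (𝓝 a) := by
  let e := toEuclidean (E := X)
  let φ : EuclideanSpace ℝ (Fin (Module.finrank ℝ X)) →
      EuclideanSpace ℝ (Fin (Module.finrank ℝ X)) :=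
    fun z => e (ψ (a + e.symm z) - ψ a)
  have hφ : ∃ C', LipschitzWith C' φ :=
    ⟨_, e.lipschitz.comp ((hψ.comp ((LipschitzWith.const a).add e.symm.lipschitz)).sub
      (LipschitzWith.const (ψ a)))⟩
  obtain ⟨C', hφ⟩ := hφ
  have hφd : HasFDerivAt φ (ContinuousLinearMap.id ℝ _) 0 := by
    have h1 : HasFDerivAt (fun z => a + e.symm z)
        (e.symm : EuclideanSpace ℝ (Fin (Module.finrank ℝ X)) →L[ℝ] X) 0 :=
      e.symm.hasFDerivAt.const_add a
    have h2 : HasFDerivAt ψ (ContinuousLinearMap.id ℝ X) (a + e.symm 0) := by simpa using hd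
    have h3 := (e.hasFDerivAt (x := ψ (a + e.symm 0) - ψ a)).comp 0 ((h2.comp 0 h1).sub_const (ψ a))
    have h4 : (e : X →L[ℝ] _) ∘L ContinuousLinearMap.id ℝ X ∘L
        (e.symm : EuclideanSpace ℝ (Fin (Module.finrank ℝ X)) →L[ℝ] X) =
          ContinuousLinearMap.id ℝ _ := ContinuousLinearMap.ext fun z => by simp
    rw [h4] at h3
    exact h3
  have hφ0 : φ 0 = 0 := by simp [φ]
  intro T hT
  have hT' : (fun z => a + e.symm z) ⁻¹' (ψ ⁻¹' T) ∈ 𝓝 0 :=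
    (by fun_prop : Continuous fun z => a + e.symm z).continuousAt (by simpa using hT)
  have hlit := hφd.isLittleO.def (show (0 : ℝ) < 1 / 8 by norm_num)
  obtain ⟨r, hr, hball⟩ := Metric.nhds_basis_closedBall.mem_iff.1 (inter_mem hT' hlit)
  have hnear : ∀ᶠ q in 𝓝 (ψ a), ‖e (q - ψ a)‖ < r / 8 := by
    have hc : Continuous fun q => ‖e (q - ψ a)‖ := by fun_prop
    exact hc.continuousAt.eventually_lt_const (by simpa using hr)
  filter_upwards [hnear] with q hq
  obtain ⟨z, hz, hzq⟩ := hφ.exists_eq_of_norm_sub_le hr (fun z hz => by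
    have h := (hball (mem_closedBall_zero_iff.2 hz)).2
    simp only [hφ0, sub_zero, ContinuousLinearMap.id_apply, mem_ofPred_eq] at h
    linarith) hq.le
  have h := (hball (mem_closedBall_zero_iff.2 hz)).1
  have hq' : ψ (a + e.symm z) = q := sub_left_injective (e.injective hzq)
  rw [← hq']
  exact h

/-- A Lipschitz map all of whose one-sided directional derivatives at `0` are given by a
continuous linear map is differentiable there. -/
theorem LipschitzWith.hasFDerivAt_zero_of_tendsto
    {X F : Type*} [NormedAddCommGroup X] [NormedSpace ℝ X] [FiniteDimensional ℝ X]
    [NormedAddCommGroup F] [NormedSpace ℝ F]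
    {ψ : X → F} {C : NNReal} (hψ : LipschitzWith C ψ) {L : X →L[ℝ] F}
    (h : ∀ v, Tendsto (fun t : ℝ => t⁻¹ • (ψ (t • v) - ψ 0)) (𝓝[>] 0) (𝓝 (L v))) :
    HasFDerivAt ψ L 0 := by
  refine hψ.hasFDerivAt_of_hasLineDerivAt_of_closure (s := univ) (by simp) fun v _ => ?_
  rw [HasLineDerivAt, hasDerivAt_iff_tendsto_slope_left_right]
  constructor
  · have h1 := ((h (-v)).comp (tendsto_neg_nhdsLT (a := (0 : ℝ)) |>.trans (by simp))).neg
    refine (h1.congr fun t => ?_).trans (by simp)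
    simp [slope_def_module]
  · refine (h v).congr fun t => ?_
    simp [slope_def_module]

end LipschitzLocalSurjectivity

/-- In finite dimensions: if `g : U → V` and `f : V → U` are inverse homeomorphisms,
`g` has a Gâteaux derivative `D` at `x ∈ U`, and `f` is Lipschitz on `V`, then `D` is a
linear isomorphism of `X` onto `Y` (i.e. `D` is bijective). -/
theorem gateaux_deriv_bijective_of_finiteDimensional
    {X Y : Type*} [NormedAddCommGroup X] [NormedSpace ℝ X] [FiniteDimensional ℝ X]
    [NormedAddCommGroup Y] [NormedSpace ℝ Y] [FiniteDimensional ℝ Y]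
    {U : Set X} {V : Set Y} (hU : IsOpen U) (hUne : U.Nonempty)
    (hV : IsOpen V) (hVne : V.Nonempty)
    (g : X → Y) (f : Y → X)
    (hgc : ContinuousOn g U) (hfc : ContinuousOn f V)
    (hgUV : Set.MapsTo g U V) (hfVU : Set.MapsTo f V U)
    (hfg : ∀ x ∈ U, f (g x) = x) (hgf : ∀ y ∈ V, g (f y) = y)
    {x : X} (hx : x ∈ U) (D : X →L[ℝ] Y)
    (hD : ∀ v : X, Tendsto (fun t : ℝ => t⁻¹ • (g (x + t • v) - g x)) (𝓝[>] 0) (𝓝 (D v)))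
    {K : NNReal} (hf : LipschitzOnWith K f V) :
    Function.Bijective D := by
  obtain ⟨F, hF, hfF⟩ := hf.extend_finite_dimension
  have hFg : ∀ z ∈ U, F (g z) = z := fun z hz => by rw [← hfF (hgUV hz), hfg z hz]
  have hψ := hF.comp ((LipschitzWith.const (g x)).add D.lipschitz)
  set ψ : X → X := F ∘ fun v => g x + D v
  have hψ0 : ψ 0 = x := by simp [ψ, hFg x hx]
  have hlim : ∀ v, Tendsto (fun t : ℝ => t⁻¹ • (ψ (t • v) - ψ 0)) (𝓝[>] 0) (𝓝 v) := by
    intro v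
    rw [tendsto_iff_norm_sub_tendsto_zero]
    have hbound := ((tendsto_iff_norm_sub_tendsto_zero.1 (hD v)).const_mul
      ((lipschitzExtensionConstant X * K : NNReal) : ℝ))
    rw [mul_zero] at hbound
    refine squeeze_zero' (Eventually.of_forall fun _ => norm_nonneg _) ?_ hbound
    have hU' : ∀ᶠ t : ℝ in 𝓝[>] 0, x + t • v ∈ U := by
      have hc : Continuous fun t : ℝ => x + t • v := by fun_prop
      exact nhdsWithin_le_nhds (hc.continuousAt (hU.mem_nhds (by simpa using hx)))
    filter_upwards [hU', self_mem_nhdsWithin] with t htU ht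
    have ht0 : t ≠ 0 := (Set.mem_Ioi.1 ht).ne'
    have h1 : t⁻¹ • (ψ (t • v) - ψ 0) - v =
        t⁻¹ • (F (g x + t • D v) - F (g (x + t • v))) := by
      rw [hψ0, hFg _ htU, ← sub_sub, smul_sub _ _ (t • v), inv_smul_smul₀ ht0]
      simp [ψ]
    have h2 : t⁻¹ • (g (x + t • v) - g x) - D v = t⁻¹ • (g (x + t • v) - (g x + t • D v)) := by
      rw [← sub_sub, smul_sub _ _ (t • D v), inv_smul_smul₀ ht0]
    rw [h1, h2, norm_smul, norm_smul, mul_left_comm, norm_sub_rev]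
    gcongr
    exact hF.norm_sub_le _ _
  constructor
  · rw [injective_iff_map_eq_zero]
    intro v hv
    refine tendsto_nhds_unique (hlim v) (tendsto_const_nhds.congr fun t => ?_)
    simp [ψ, hv]
  · have hopen := hψ.nhds_le_map_of_hasFDerivAt_id (hψ.hasFDerivAt_zero_of_tendsto hlim)
    have hVn : ∀ᶠ y in 𝓝 (0 : Y), g x + y ∈ V := by
      have hc : Continuous fun y : Y => g x + y := by fun_prop
      exact hc.continuousAt (hV.mem_nhds (by simpa using hgUV hx))
    have hTn : {v | g x + D v ∈ V} ∈ 𝓝 (0 : X) :=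
      D.continuous.continuousAt (by rw [map_zero]; exact hVn)
    have himg : ψ '' {v | g x + D v ∈ V} ∈ 𝓝 (ψ 0) := hopen (image_mem_map hTn)
    have hFn : ∀ᶠ y in 𝓝 (0 : Y), F (g x + y) ∈ ψ '' {v | g x + D v ∈ V} := by
      have hc : Continuous fun y : Y => F (g x + y) := hF.continuous.comp (by fun_prop)
      exact hc.continuousAt (by simpa [ψ] using himg)
    have hrange : (D.range : Set Y) ∈ 𝓝 (0 : Y) := by
      filter_upwards [hVn, hFn] with y hy ⟨v, hv, hvy⟩
      have h : f (g x + D v) = f (g x + y) := by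
        rw [hfF hv, hfF hy]
        exact hvy
      have h' := congrArg g h
      rw [hgf _ hv, hgf _ hy] at h'
      exact ⟨v, add_left_cancel h'⟩
    exact LinearMap.range_eq_top.1
      (Submodule.eq_top_of_nonempty_interior' _ ⟨0, mem_interior_iff_mem_nhds.2 hrange⟩)
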